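/- Let Σ be a topologically transitive one-sided Markov shift over the countable alphabet ℤ₊ and A : Σ → ℝ a potential of summable variation. Then for every fixed ȳ ∈ Σ, the map x ↦ φ_A(x,ȳ) = h_A(x,ȳ) defined on the Aubry set Ω(A) is real-valued, continuous, and its ℓ-th variation on Ω(A) is bounded above by Var_ℓ^∞(A) for every ℓ ≥ 1; in particular, if ∑_{ℓ=1}^∞ Var_ℓ^∞(A) < ∞, then h_A(·,ȳ)|_{Ω(A)} has summable variation. -/

import Mathlib

open MeasureTheory Filter Set
open scoped ENNReal

namespace CMS

/-- The one-sided Markov shift `Σ` over the countable alphabet `ℕ = ℤ₊`,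
determined by the transition matrix `Tr`. -/
abbrev SS (Tr : ℕ → ℕ → Prop) : Type := {x : ℕ → ℕ // ∀ n, Tr (x n) (x (n + 1))}

/-- The left shift map `σ`. -/
def shiftMap (Tr : ℕ → ℕ → Prop) (x : SS Tr) : SS Tr :=
  ⟨fun n => x.1 (n + 1), fun n => x.2 (n + 1)⟩

open scoped Classical in
/-- The metric `d(x,y) = λ^ℓ`, `ℓ` the first index of disagreement (`0` if `x = y`). -/
noncomputable def sdist (lam : ℝ) {Tr : ℕ → ℕ → Prop} (x y : SS Tr) : ℝ :=
  if h : ∃ n, x.1 n ≠ y.1 n then lam ^ Nat.find h else 0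

/-- Birkhoff sum `S_n f`. -/
noncomputable def birk {Tr : ℕ → ℕ → Prop} (f : SS Tr → ℝ) (n : ℕ) (x : SS Tr) : ℝ :=
  ∑ i ∈ Finset.range n, f ((shiftMap Tr)^[i] x)

/-- `ℓ`-th variation of `f` restricted to a subset `s` (valued in `ℝ≥0∞`). -/
noncomputable def varAtOn (lam : ℝ) {Tr : ℕ → ℕ → Prop} (s : Set (SS Tr))
    (f : SS Tr → ℝ) (ℓ : ℕ) : ℝ≥0∞ :=
  ⨆ (x ∈ s) (y ∈ s) (_ : sdist lam x y ≤ lam ^ ℓ), ENNReal.ofReal (f x - f y)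

/-- `ℓ`-th variation `Var_ℓ(f)`. -/
noncomputable def varAt (lam : ℝ) {Tr : ℕ → ℕ → Prop} (f : SS Tr → ℝ) (ℓ : ℕ) : ℝ≥0∞ :=
  varAtOn lam Set.univ f ℓ

/-- `Var_k^∞(f) = ∑_{ℓ ≥ k} Var_ℓ(f)`. -/
noncomputable def varFrom (lam : ℝ) {Tr : ℕ → ℕ → Prop} (f : SS Tr → ℝ) (k : ℕ) : ℝ≥0∞ :=
  ∑' ℓ : ℕ, varAt lam f (k + ℓ)

/-- `f` has summable variation: `Var_1^∞(f) < ∞`. -/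
def SummableVar (lam : ℝ) {Tr : ℕ → ℕ → Prop} (f : SS Tr → ℝ) : Prop :=
  varFrom lam f 1 < ⊤

/-- `f` is locally Hölder continuous: `Var_ℓ(f) ≤ C λ^ℓ` for all `ℓ ≥ 1`. -/
def LocHolder (lam : ℝ) {Tr : ℕ → ℕ → Prop} (f : SS Tr → ℝ) : Prop :=
  ∃ C : ℝ, 0 < C ∧ ∀ ℓ : ℕ, 1 ≤ ℓ → varAt lam f ℓ ≤ ENNReal.ofReal (C * lam ^ ℓ)

/-- `‖A - B‖_sv = Var_1^∞(A-B) + ‖A-B‖_∞`. -/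
noncomputable def svDist (lam : ℝ) {Tr : ℕ → ℕ → Prop} (A B : SS Tr → ℝ) : ℝ≥0∞ :=
  varFrom lam (fun x => A x - B x) 1 + ⨆ x : SS Tr, ENNReal.ofReal |A x - B x|

/-- `A` is a potential: continuous and bounded from above. -/
def IsPotential {Tr : ℕ → ℕ → Prop} (A : SS Tr → ℝ) : Prop :=
  Continuous A ∧ BddAbove (Set.range A)

/-- Topological transitivity of the shift. -/
def TopTransitive (Tr : ℕ → ℕ → Prop) : Prop :=
  ∀ U V : Set (SS Tr), IsOpen U → IsOpen V → U.Nonempty → V.Nonempty →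
    ∃ n : ℕ, ((shiftMap Tr)^[n] '' U ∩ V).Nonempty

/-- The ergodic maximizing constant `β_A`. -/
noncomputable def beta {Tr : ℕ → ℕ → Prop} (A : SS Tr → ℝ) : ℝ :=
  sSup {r : ℝ | ∃ μ : Measure (SS Tr), IsProbabilityMeasure μ ∧
    μ.map (shiftMap Tr) = μ ∧ r = ∫ x, A x ∂μ}

/-- `μ` is an `A`-maximizing (shift-invariant Borel probability) measure. -/
def Maximizing {Tr : ℕ → ℕ → Prop} (A : SS Tr → ℝ) (μ : Measure (SS Tr)) : Prop :=
  IsProbabilityMeasure μ ∧ μ.map (shiftMap Tr) = μ ∧ ∫ x, A x ∂μ = beta A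

/-- Topological support of a measure. -/
def msupport {Tr : ℕ → ℕ → Prop} (μ : Measure (SS Tr)) : Set (SS Tr) :=
  {x | ∀ U : Set (SS Tr), IsOpen U → x ∈ U → 0 < μ U}

/-- `μ` is the uniform probability measure on a periodic orbit. -/
def PeriodicOrbitMeasure {Tr : ℕ → ℕ → Prop} (μ : Measure (SS Tr)) : Prop :=
  ∃ (y : SS Tr) (p : ℕ), 1 ≤ p ∧ (shiftMap Tr)^[p] y = y ∧
    μ = (p : ℝ≥0∞)⁻¹ • ∑ i ∈ Finset.range p, Measure.dirac ((shiftMap Tr)^[i] y)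

/-- `A` is coercive: `lim_{i→∞} sup A|_[i] = -∞`. -/
def Coercive {Tr : ℕ → ℕ → Prop} (A : SS Tr → ℝ) : Prop :=
  ∀ M : ℝ, ∃ N : ℕ, ∀ i : ℕ, N ≤ i → ∀ x : SS Tr, x.1 0 = i → A x ≤ M

/-- The Aubry set `Ω(A)`. -/
def Aubry (lam : ℝ) {Tr : ℕ → ℕ → Prop} (A : SS Tr → ℝ) : Set (SS Tr) :=
  {x | ∀ ε : ℝ, 0 < ε → ∃ (w : SS Tr) (n : ℕ), 0 < n ∧
    sdist lam x w < ε ∧ sdist lam ((shiftMap Tr)^[n] w) x < ε ∧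
    -ε < (n : ℝ) * beta A - birk A n w ∧ (n : ℝ) * beta A - birk A n w < ε}

/-- The auxiliary function `𝔖^k_l(x,y)` at level `γ`. -/
noncomputable def aux (lam : ℝ) {Tr : ℕ → ℕ → Prop} (A : SS Tr → ℝ) (γ : ℝ)
    (k l : ℕ) (x y : SS Tr) : EReal :=
  ⨅ (n : ℕ) (_ : l ≤ n) (w : SS Tr)
    (_ : sdist lam x w ≤ lam ^ k) (_ : sdist lam ((shiftMap Tr)^[n] w) y ≤ lam ^ k),
    (((n : ℝ) * γ - birk A n w : ℝ) : EReal)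

/-- The Mañé potential `φ^γ_A(x,y)`. -/
noncomputable def mane (lam : ℝ) {Tr : ℕ → ℕ → Prop} (A : SS Tr → ℝ) (γ : ℝ)
    (x y : SS Tr) : EReal :=
  ⨆ k : ℕ, aux lam A γ k 1 x y

/-- The Peierls barrier `h^γ_A(x,y)`. -/
noncomputable def peierls (lam : ℝ) {Tr : ℕ → ℕ → Prop} (A : SS Tr → ℝ) (γ : ℝ)
    (x y : SS Tr) : EReal :=
  ⨆ (k : ℕ) (l : ℕ), aux lam A γ k (l + 1) x y

section Agreement

variable {Tr : ℕ → ℕ → Prop}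

/-- `x` and `y` coincide on their first `k` symbols. -/
def Agree (k : ℕ) (x y : SS Tr) : Prop := ∀ i < k, x.1 i = y.1 i

theorem Agree.symm {k : ℕ} {x y : SS Tr} (h : Agree k x y) : Agree k y x :=
  fun i hi => (h i hi).symm

theorem Agree.trans {k : ℕ} {x y z : SS Tr} (h : Agree k x y) (h' : Agree k y z) :
    Agree k x z := fun i hi => (h i hi).trans (h' i hi)

theorem Agree.mono {k l : ℕ} {x y : SS Tr} (h : Agree l x y) (hkl : k ≤ l) : Agree k x y :=
  fun i hi => h i (hi.trans_le hkl)

theorem sdist_le_pow_iff {lam : ℝ} (hlam0 : 0 < lam) (hlam1 : lam < 1) {k : ℕ} {x y : SS Tr} :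
    sdist lam x y ≤ lam ^ k ↔ Agree k x y := by
  classical
  unfold sdist
  split_ifs with h
  · rw [pow_le_pow_iff_right_of_lt_one₀ hlam0 hlam1, Nat.le_find_iff]
    simp [Agree]
  · push Not at h
    exact ⟨fun _ i _ => h i, fun _ => by positivity⟩

theorem iterate_shiftMap_apply (n : ℕ) (x : SS Tr) (i : ℕ) :
    ((shiftMap Tr)^[n] x).1 i = x.1 (i + n) := by
  induction n generalizing x with
  | zero => rfl
  | succ n ih =>
    rw [Function.iterate_succ_apply, ih]
    simp [shiftMap, add_assoc]

theorem exists_concat {k : ℕ} (hk : 1 ≤ k) (n : ℕ) (w z : SS Tr)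
    (h : Agree k ((shiftMap Tr)^[n] w) z) :
    ∃ c : SS Tr, Agree (n + k) c w ∧ (shiftMap Tr)^[n] c = z := by
  have hz : ∀ i < k, z.1 i = w.1 (i + n) := fun i hi => by
    rw [← h i hi, iterate_shiftMap_apply]
  refine ⟨⟨fun i => if i < n then w.1 i else z.1 (i - n), fun i => ?_⟩, fun i hi => ?_, ?_⟩
  · rcases lt_trichotomy (i + 1) n with h1 | h1 | h1
    · simpa [h1, (show i < n by omega)] using w.2 i
    · have h0 := hz 0 (by omega)
      have := w.2 i
      subst h1
      simpa [h0] using this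
    · have := z.2 (i - n)
      simpa [show ¬ i < n by omega, show ¬ i + 1 < n by omega,
        show i + 1 - n = i - n + 1 by omega] using this
  · by_cases hin : i < n
    · simp [hin]
    · simp [hin, hz (i - n) (by omega), Nat.sub_add_cancel (not_lt.1 hin)]
  · ext i
    rw [iterate_shiftMap_apply]
    simp

theorem exists_periodic {n : ℕ} (hn : 1 ≤ n) (w : SS Tr) (h : w.1 n = w.1 0) :
    ∃ p : SS Tr, (shiftMap Tr)^[n] p = p ∧ Agree (n + 1) p w := by
  refine ⟨⟨fun i => w.1 (i % n), fun i => ?_⟩, ?_, fun i hi => ?_⟩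
  · show Tr (w.1 (i % n)) (w.1 ((i + 1) % n))
    have h1 := w.2 (i % n)
    have h2 := Nat.mod_lt i hn
    rcases (show i % n + 1 ≤ n by omega).lt_or_eq with h3 | h3
    · rwa [show (i + 1) % n = i % n + 1 by rw [← Nat.mod_add_mod, Nat.mod_eq_of_lt h3]]
    · rw [h3, h] at h1
      rwa [show (i + 1) % n = 0 by rw [← Nat.mod_add_mod, h3, Nat.mod_self]]
  · ext i
    rw [iterate_shiftMap_apply]
    simp
  · rcases (show i ≤ n by omega).lt_or_eq with h3 | rfl
    · simp [Nat.mod_eq_of_lt h3]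
    · simp [h]

theorem isOpen_agree (k : ℕ) (x : SS Tr) : IsOpen {y : SS Tr | Agree k x y} := by
  have : {y : SS Tr | Agree k x y} = ⋂ i ∈ Finset.range k, {y : SS Tr | y.1 i = x.1 i} := by
    ext y
    simp [Agree, eq_comm]
  rw [this]
  refine isOpen_biInter_finset fun i _ => ?_
  have hc : Continuous fun y : SS Tr => y.1 i := (continuous_apply i).comp continuous_subtype_val
  exact (isOpen_discrete {x.1 i}).preimage hc

theorem exists_connecting (htr : TopTransitive Tr) (x y : SS Tr) :
    ∃ (z : SS Tr) (m : ℕ), Agree 1 x z ∧ (shiftMap Tr)^[m] z = y := by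
  obtain ⟨m, _, ⟨z, hz, rfl⟩, hy⟩ := htr _ _ (isOpen_agree 1 x) (isOpen_agree 1 y)
    ⟨x, fun _ _ => rfl⟩ ⟨y, fun _ _ => rfl⟩
  obtain ⟨c, hc, hcy⟩ := exists_concat le_rfl m z y (Agree.symm hy)
  exact ⟨c, m, hz.trans (hc.symm.mono (by omega)), hcy⟩

end Agreement

section Birkhoff

variable {Tr : ℕ → ℕ → Prop} {A : SS Tr → ℝ} {lam : ℝ}

theorem birk_add (n m : ℕ) (x : SS Tr) :
    birk A (n + m) x = birk A n x + birk A m ((shiftMap Tr)^[n] x) := by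
  unfold birk
  rw [Finset.sum_range_add]
  congr 1
  refine Finset.sum_congr rfl fun i _ => ?_
  rw [← Function.iterate_add_apply, add_comm]

theorem measurable_shiftMap : Measurable (shiftMap Tr) :=
  Measurable.subtype_mk (measurable_pi_lambda (fun (x : SS Tr) n => x.1 (n + 1)) fun n =>
    (measurable_pi_apply (n + 1)).comp measurable_subtype_coe)

theorem integral_le_beta (hA : BddAbove (range A)) (μ : Measure (SS Tr))
    [IsProbabilityMeasure μ] (hμ : μ.map (shiftMap Tr) = μ) : ∫ x, A x ∂μ ≤ beta A := by
  refine le_csSup ?_ ⟨μ, inferInstance, hμ, rfl⟩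
  obtain ⟨M, hM⟩ := hA
  refine ⟨max M 0, ?_⟩
  rintro _ ⟨ν, hν, -, rfl⟩
  by_cases hint : Integrable A ν
  · refine le_max_of_le_left ?_
    simpa using integral_mono hint (integrable_const M) fun x => hM ⟨x, rfl⟩
  · rw [integral_undef hint]
    exact le_max_right _ _

theorem birk_le_of_periodic (hA : BddAbove (range A)) {n : ℕ} (hn : 1 ≤ n)
    {p : SS Tr} (hp : (shiftMap Tr)^[n] p = p) : birk A n p ≤ n * beta A := by
  have hn0 : (n : ℝ≥0∞) ≠ 0 := by simp; omega
  set μ : Measure (SS Tr) :=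
    (n : ℝ≥0∞)⁻¹ • ∑ i ∈ Finset.range n, Measure.dirac ((shiftMap Tr)^[i] p) with hμ
  have hprob : IsProbabilityMeasure μ := ⟨by
    simp [hμ, ENNReal.inv_mul_cancel hn0 (ENNReal.natCast_ne_top n)]⟩
  have hinv : μ.map (shiftMap Tr) = μ := by
    ext s hs
    rw [Measure.map_apply measurable_shiftMap hs, hμ]
    simp only [Measure.smul_apply, Measure.finsetSum_apply, smul_eq_mul]
    congr 1
    have h1 : ∀ i, Measure.dirac ((shiftMap Tr)^[i] p) (shiftMap Tr ⁻¹' s) =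
        Measure.dirac ((shiftMap Tr)^[i + 1] p) s := fun i => by
      rw [Measure.dirac_apply' _ (measurable_shiftMap hs), Measure.dirac_apply' _ hs,
        Function.iterate_succ_apply']
      rfl
    simp only [h1]
    obtain ⟨m, rfl⟩ : ∃ m, n = m + 1 := ⟨n - 1, by omega⟩
    rw [Finset.sum_range_succ, hp, Finset.sum_range_succ']
    rfl
  have h := integral_le_beta hA μ hinv
  rw [hμ, integral_smul_measure,
    integral_finsetSum_measure fun i _ => integrable_dirac (by simp)] at h
  simp only [integral_dirac, ENNReal.toReal_inv, ENNReal.toReal_natCast, smul_eq_mul] at h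
  have hnpos : (0 : ℝ) < n := by exact_mod_cast hn
  rwa [inv_mul_le_iff₀ hnpos] at h

theorem varFrom_ne_top (hA : SummableVar lam A) {k : ℕ} (hk : 1 ≤ k) :
    varFrom lam A k ≠ ⊤ := by
  refine ne_top_of_le_ne_top hA.ne ?_
  obtain ⟨m, rfl⟩ := Nat.exists_eq_add_of_le hk
  unfold varFrom
  simp only [add_assoc]
  exact ENNReal.tsum_comp_le_tsum_of_injective (add_right_injective m)
    fun ℓ => varAt lam A (1 + ℓ)

theorem tendsto_varFrom (hA : SummableVar lam A) :
    Tendsto (fun k => (varFrom lam A (k + 1)).toReal) atTop (nhds 0) := by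
  have h := ENNReal.tendsto_sum_nat_add (fun ℓ => varAt lam A (1 + ℓ)) hA.ne
  have h2 := (ENNReal.tendsto_toReal ENNReal.zero_ne_top).comp h
  refine h2.congr fun k => ?_
  simp only [Function.comp, varFrom]
  congr 2
  ext ℓ
  congr 1
  ring

theorem varFrom_succ_le (k : ℕ) : varFrom lam A (k + 1) ≤ varFrom lam A k := by
  unfold varFrom
  simp only [add_assoc]
  exact ENNReal.tsum_comp_le_tsum_of_injective (add_right_injective 1)
    fun ℓ => varAt lam A (k + ℓ)

theorem sub_le_varAt (hlam0 : 0 < lam) (hlam1 : lam < 1) (hA : SummableVar lam A) {k : ℕ}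
    (hk : 1 ≤ k) {x y : SS Tr} (h : Agree k x y) : A x - A y ≤ (varAt lam A k).toReal := by
  have hfin : varAt lam A k ≠ ⊤ :=
    ne_top_of_le_ne_top (varFrom_ne_top hA hk)
      (ENNReal.le_tsum (f := fun ℓ => varAt lam A (k + ℓ)) 0)
  rw [← ENNReal.ofReal_le_iff_le_toReal hfin]
  unfold varAt varAtOn
  exact le_iSup₂_of_le x (mem_univ x) (le_iSup₂_of_le y (mem_univ y)
    (le_iSup_of_le ((sdist_le_pow_iff hlam0 hlam1).2 h) le_rfl))

theorem birk_sub_le (hlam0 : 0 < lam) (hlam1 : lam < 1) (hA : SummableVar lam A) {n k : ℕ}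
    {x y : SS Tr} (h : Agree (n + k) x y) :
    birk A n x - birk A n y ≤ (varFrom lam A (k + 1)).toReal := by
  have hfin := varFrom_ne_top hA (show 1 ≤ k + 1 by omega)
  have hle := ENNReal.sum_le_tsum (f := fun ℓ => varAt lam A (k + 1 + ℓ)) (Finset.range n)
  have hterm : ∀ ℓ, varAt lam A (k + 1 + ℓ) ≠ ⊤ := fun ℓ =>
    ne_top_of_le_ne_top hfin (ENNReal.le_tsum (f := fun ℓ => varAt lam A (k + 1 + ℓ)) ℓ)
  refine le_trans ?_ (ENNReal.toReal_mono hfin hle)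
  rw [ENNReal.toReal_sum fun ℓ _ => hterm ℓ, birk, birk, ← Finset.sum_sub_distrib,
    ← Finset.sum_range_reflect (fun ℓ => (varAt lam A (k + 1 + ℓ)).toReal)]
  refine Finset.sum_le_sum fun i hi => ?_
  have hi := Finset.mem_range.1 hi
  refine sub_le_varAt hlam0 hlam1 hA (by omega) fun j hj => ?_
  rw [iterate_shiftMap_apply, iterate_shiftMap_apply]
  exact h _ (by omega)

/-- Birkhoff sum of the normalized potential `β_A - A`. -/
noncomputable def cost (A : SS Tr → ℝ) (n : ℕ) (x : SS Tr) : ℝ := n * beta A - birk A n x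

theorem cost_add (n m : ℕ) (x : SS Tr) :
    cost A (n + m) x = cost A n x + cost A m ((shiftMap Tr)^[n] x) := by
  simp only [cost, birk_add]
  push_cast
  ring

theorem cost_le_of_agree (hlam0 : 0 < lam) (hlam1 : lam < 1) (hA : SummableVar lam A) {n k : ℕ}
    {x y : SS Tr} (h : Agree (n + k) x y) :
    cost A n x ≤ cost A n y + (varFrom lam A (k + 1)).toReal := by
  have := birk_sub_le hlam0 hlam1 hA h.symm
  simp only [cost]
  linarith

theorem neg_le_cost_of_return (hlam0 : 0 < lam) (hlam1 : lam < 1) (hb : BddAbove (range A))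
    (hA : SummableVar lam A) {n : ℕ} (hn : 1 ≤ n) {w : SS Tr} (h : w.1 n = w.1 0) :
    -(varFrom lam A 2).toReal ≤ cost A n w := by
  obtain ⟨p, hp, hpw⟩ := exists_periodic hn w h
  have h1 := birk_le_of_periodic hb hn hp
  have h2 := cost_le_of_agree hlam0 hlam1 hA hpw
  simp only [cost] at *
  norm_num at h2
  linarith

end Birkhoff

section AubrySet

variable {Tr : ℕ → ℕ → Prop} {A : SS Tr → ℝ} {lam : ℝ}

theorem exists_return_of_mem_aubry (hlam0 : 0 < lam) (hlam1 : lam < 1) (hA : SummableVar lam A)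
    {x : SS Tr} (hx : x ∈ Aubry lam A) {ε : ℝ} (hε : 0 < ε) (k l : ℕ) :
    ∃ (w : SS Tr) (n : ℕ), l ≤ n ∧ Agree k x w ∧ (shiftMap Tr)^[n] w = x ∧ cost A n w < ε := by
  set δ : ℝ := ε / (2 * (l + 1)) with hδ
  have hδ0 : 0 < δ := by positivity
  obtain ⟨K, hKv, hKk⟩ := (((tendsto_varFrom hA).eventually_lt_const hδ0).and
    (eventually_ge_atTop (max k 1))).exists
  obtain ⟨w, n, hn, h1, h2, -, h3⟩ := hx (min δ (lam ^ K)) (lt_min hδ0 (pow_pos hlam0 K))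
  replace h1 : Agree K x w :=
    (sdist_le_pow_iff hlam0 hlam1).1 (h1.le.trans (min_le_right _ _))
  replace h2 : Agree K ((shiftMap Tr)^[n] w) x :=
    (sdist_le_pow_iff hlam0 hlam1).1 (h2.le.trans (min_le_right _ _))
  replace h3 : cost A n w < δ := h3.trans_le (min_le_left _ _)
  have key : ∀ j : ℕ, ∃ v : SS Tr, Agree K x v ∧ (shiftMap Tr)^[j * n] v = x ∧
      cost A (j * n) v ≤ j * (2 * δ) := by
    intro j
    induction j with
    | zero => exact ⟨x, fun _ _ => rfl, by simp, by simp [cost, birk]⟩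
    | succ j ih =>
      obtain ⟨v, hv1, hv2, hv3⟩ := ih
      obtain ⟨c, hc1, hc2⟩ := exists_concat (by omega) n w v (h2.trans hv1)
      refine ⟨c, h1.trans (hc1.symm.mono (by omega)), ?_, ?_⟩
      · rw [Nat.succ_mul, Function.iterate_add_apply, hc2, hv2]
      · have := cost_le_of_agree hlam0 hlam1 hA hc1
        rw [Nat.succ_mul, add_comm, cost_add, hc2]
        push_cast
        linarith
  obtain ⟨v, hv1, hv2, hv3⟩ := key l
  refine ⟨v, l * n, Nat.le_mul_of_pos_right l hn, hv1.mono (by omega), hv2, hv3.trans_lt ?_⟩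
  have : (l : ℝ) * (2 * δ) = ε * (l / (l + 1)) := by
    rw [hδ]
    field_simp
  rw [this]
  refine mul_lt_of_lt_one_right hε ?_
  rw [div_lt_one (by positivity)]
  linarith

theorem aux_mono (γ : ℝ) {k k' l l' : ℕ} (hlam0 : 0 < lam) (hlam1 : lam < 1) (hk : k ≤ k')
    (hl : l ≤ l') (x y : SS Tr) : aux lam A γ k l x y ≤ aux lam A γ k' l' x y := by
  have hpow : lam ^ k' ≤ lam ^ k := pow_le_pow_of_le_one hlam0.le hlam1.le hk
  unfold aux
  exact le_iInf₂ fun n hn => le_iInf₂ fun w hw => le_iInf fun hwy =>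
    iInf₂_le_of_le n (hl.trans hn) (iInf₂_le_of_le w (hw.trans hpow)
      (iInf_le_of_le (hwy.trans hpow) le_rfl))

theorem aux_le_cost (hlam0 : 0 < lam) (hlam1 : lam < 1) {k l n : ℕ} (hn : l ≤ n) {x y w : SS Tr}
    (hxw : Agree k x w) (hwy : Agree k ((shiftMap Tr)^[n] w) y) :
    aux lam A (beta A) k l x y ≤ (cost A n w : EReal) := by
  unfold aux
  exact iInf₂_le_of_le n hn (iInf₂_le_of_le w ((sdist_le_pow_iff hlam0 hlam1).2 hxw)
    (iInf_le_of_le ((sdist_le_pow_iff hlam0 hlam1).2 hwy) le_rfl))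

theorem le_aux (hlam0 : 0 < lam) (hlam1 : lam < 1) {k l : ℕ} {x y : SS Tr} {r : EReal}
    (h : ∀ (n : ℕ) (w : SS Tr), l ≤ n → Agree k x w → Agree k ((shiftMap Tr)^[n] w) y →
      r ≤ (cost A n w : EReal)) :
    r ≤ aux lam A (beta A) k l x y := by
  unfold aux
  exact le_iInf₂ fun n hn => le_iInf₂ fun w hw => le_iInf fun hwy =>
    h n w hn ((sdist_le_pow_iff hlam0 hlam1).1 hw) ((sdist_le_pow_iff hlam0 hlam1).1 hwy)

theorem aux_le_aux_add (hlam0 : 0 < lam) (hlam1 : lam < 1) (hA : SummableVar lam A)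
    {x x' : SS Tr} (hx : x ∈ Aubry lam A) (y : SS Tr) {ℓ : ℕ} (hℓ : 1 ≤ ℓ) (hxx' : Agree ℓ x x')
    {ε : ℝ} (hε : 0 < ε) (k l : ℕ) :
    aux lam A (beta A) k l x y ≤
      aux lam A (beta A) (max k ℓ) 0 x' y +
        (((varFrom lam A (ℓ + 1)).toReal + ε : ℝ) : EReal) := by
  refine (EReal.sub_le_iff_le_add (.inl (EReal.coe_ne_bot _)) (.inl (EReal.coe_ne_top _))).1 ?_
  refine le_aux hlam0 hlam1 fun n w _ hw hwy => EReal.sub_le_of_le_add ?_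
  obtain ⟨v, N, hN, hv1, hv2, hv3⟩ :=
    exists_return_of_mem_aubry hlam0 hlam1 hA hx hε k (max k l)
  obtain ⟨c, hc1, hc2⟩ := exists_concat hℓ N v w
    (hv2 ▸ hxx'.trans (hw.mono (le_max_right _ _)))
  refine (aux_le_cost hlam0 hlam1 (n := N + n) (w := c) (by omega)
    (hv1.trans (hc1.symm.mono (by omega))) ?_).trans ?_
  · rw [add_comm, Function.iterate_add_apply, hc2]
    exact hwy.mono (le_max_left _ _)
  · have := cost_le_of_agree hlam0 hlam1 hA hc1
    rw [cost_add, hc2, ← EReal.coe_add, EReal.coe_le_coe_iff]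
    linarith

theorem mane_le_peierls (γ : ℝ) (x y : SS Tr) : mane lam A γ x y ≤ peierls lam A γ x y :=
  iSup_mono fun _ => le_iSup_of_le 0 le_rfl

theorem peierls_le_mane_add (hlam0 : 0 < lam) (hlam1 : lam < 1) (hA : SummableVar lam A)
    {x x' : SS Tr} (hx : x ∈ Aubry lam A) (y : SS Tr) {ℓ : ℕ} (hℓ : 1 ≤ ℓ) (hxx' : Agree ℓ x x')
    {ε : ℝ} (hε : 0 < ε) :
    peierls lam A (beta A) x y ≤ mane lam A (beta A) x' y +
      (((varFrom lam A (ℓ + 1)).toReal + ε : ℝ) : EReal) := by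
  refine iSup₂_le fun k l => (aux_le_aux_add hlam0 hlam1 hA hx y hℓ hxx' hε k (l + 1)).trans ?_
  exact add_le_add_left ((aux_mono _ hlam0 hlam1 le_rfl zero_le_one x' y).trans
    (le_iSup (fun k => aux lam A (beta A) k 1 x' y) _)) _

theorem peierls_ne_top (hlam0 : 0 < lam) (hlam1 : lam < 1) (htr : TopTransitive Tr)
    (hA : SummableVar lam A) {x : SS Tr} (hx : x ∈ Aubry lam A) (y : SS Tr) :
    peierls lam A (beta A) x y ≠ ⊤ := by
  obtain ⟨z, m, hz, hzy⟩ := exists_connecting htr x y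
  refine ne_top_of_le_ne_top (EReal.coe_ne_top
    (cost A m z + ((varFrom lam A (1 + 1)).toReal + 1))) (iSup₂_le fun k l => ?_)
  refine (aux_le_aux_add hlam0 hlam1 hA hx y le_rfl hz one_pos k (l + 1)).trans ?_
  rw [EReal.coe_add]
  exact add_le_add_left
    (aux_le_cost hlam0 hlam1 (Nat.zero_le m) (fun _ _ => rfl) (hzy ▸ fun _ _ => rfl)) _

theorem mane_ne_bot (hlam0 : 0 < lam) (hlam1 : lam < 1) (htr : TopTransitive Tr)
    (hb : BddAbove (range A)) (hA : SummableVar lam A) (x y : SS Tr) :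
    mane lam A (beta A) x y ≠ ⊥ := by
  obtain ⟨z, m, hz, hzx⟩ := exists_connecting htr y x
  refine ne_bot_of_le_ne_bot (EReal.coe_ne_bot
    (-(varFrom lam A 2).toReal - (varFrom lam A 2).toReal - cost A m z)) ?_
  refine le_trans (le_aux hlam0 hlam1 fun n w hn hw hwy => ?_)
    (le_iSup (fun k => aux lam A (beta A) k 1 x y) 1)
  obtain ⟨c, hc1, hc2⟩ := exists_concat le_rfl n w z (hwy.trans hz)
  have h1 := cost_le_of_agree hlam0 hlam1 hA hc1
  have hend : c.1 (n + m) = x.1 0 := by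
    rw [← hzx, ← hc2, ← Function.iterate_add_apply, iterate_shiftMap_apply, Nat.zero_add,
      Nat.add_comm]
  have h2 := neg_le_cost_of_return hlam0 hlam1 hb hA (show 1 ≤ n + m by omega)
    (hend.trans ((hw 0 one_pos).trans (hc1 0 (by omega)).symm))
  rw [cost_add, hc2] at h2
  rw [EReal.coe_le_coe_iff]
  norm_num at h1
  linarith

theorem peierls_eq_mane (hlam0 : 0 < lam) (hlam1 : lam < 1) (hA : SummableVar lam A)
    {x : SS Tr} (hx : x ∈ Aubry lam A) (y : SS Tr) :
    peierls lam A (beta A) x y = mane lam A (beta A) x y := by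
  refine le_antisymm ?_ (mane_le_peierls _ x y)
  refine EReal.le_of_forall_lt_iff_le.1 fun r hr => ?_
  obtain ⟨s, hs, hsr⟩ := EReal.lt_iff_exists_real_btwn.1 hr
  have hsr' : 0 < (r - s) / 2 := half_pos (sub_pos.2 (EReal.coe_lt_coe_iff.1 hsr))
  obtain ⟨ℓ, hv, hℓ⟩ := (((tendsto_varFrom hA).eventually_lt_const hsr').and
    (eventually_ge_atTop 1)).exists
  refine (peierls_le_mane_add hlam0 hlam1 hA hx y hℓ (fun _ _ => rfl) hsr').trans ?_
  refine (add_le_add_left hs.le _).trans ?_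
  rw [← EReal.coe_add, EReal.coe_le_coe_iff]
  linarith

end AubrySet

theorem peierls_regularity_first_variable_on_aubry
    (lam : ℝ) (hlam0 : 0 < lam) (hlam1 : lam < 1)
    (Tr : ℕ → ℕ → Prop) (htr : TopTransitive Tr)
    (A : SS Tr → ℝ) (hA : IsPotential A) (hAsv : SummableVar lam A)
    (ybar : SS Tr) :
    ∃ u : SS Tr → ℝ,
      (∀ x ∈ Aubry lam A, mane lam A (beta A) x ybar = (u x : EReal) ∧
        peierls lam A (beta A) x ybar = (u x : EReal)) ∧
      ContinuousOn u (Aubry lam A) ∧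
      (∀ ℓ : ℕ, 1 ≤ ℓ → varAtOn lam (Aubry lam A) u ℓ ≤ varFrom lam A ℓ) ∧
      ((∑' ℓ : ℕ, varFrom lam A (1 + ℓ)) < ⊤ →
        (∑' ℓ : ℕ, varAtOn lam (Aubry lam A) u (1 + ℓ)) < ⊤) := by
  set u : SS Tr → ℝ := fun x => (peierls lam A (beta A) x ybar).toReal with hu
  have hP : ∀ x ∈ Aubry lam A, peierls lam A (beta A) x ybar = (u x : EReal) := fun x hx =>
    (EReal.coe_toReal (peierls_ne_top hlam0 hlam1 htr hAsv hx ybar)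
      (ne_bot_of_le_ne_bot (mane_ne_bot hlam0 hlam1 htr hA.2 hAsv x ybar)
        (mane_le_peierls _ x ybar))).symm
  have hM : ∀ x ∈ Aubry lam A, mane lam A (beta A) x ybar = (u x : EReal) := fun x hx => by
    rw [← peierls_eq_mane hlam0 hlam1 hAsv hx, hP x hx]
  have hdiff : ∀ x ∈ Aubry lam A, ∀ x' ∈ Aubry lam A, ∀ ℓ : ℕ, 1 ≤ ℓ → Agree ℓ x x' →
      u x - u x' ≤ (varFrom lam A (ℓ + 1)).toReal := by
    intro x hx x' hx' ℓ hℓ h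
    refine le_of_forall_pos_le_add fun ε hε => ?_
    have := peierls_le_mane_add hlam0 hlam1 hAsv hx ybar hℓ h hε
    rw [hP x hx, hM x' hx', ← EReal.coe_add, EReal.coe_le_coe_iff] at this
    linarith
  have hvar : ∀ ℓ : ℕ, 1 ≤ ℓ → varAtOn lam (Aubry lam A) u ℓ ≤ varFrom lam A ℓ := by
    intro ℓ hℓ
    unfold varAtOn
    refine iSup₂_le fun x hx => iSup₂_le fun x' hx' => iSup_le fun h => ?_
    have h1 := hdiff x hx x' hx' ℓ hℓ ((sdist_le_pow_iff hlam0 hlam1).1 h)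
    exact (ENNReal.ofReal_le_of_le_toReal h1).trans (varFrom_succ_le ℓ)
  refine ⟨u, fun x hx => ⟨hM x hx, hP x hx⟩, fun x hx => ?_, hvar, fun h => ?_⟩
  · rw [ContinuousWithinAt, Metric.tendsto_nhds]
    intro ε hε
    obtain ⟨ℓ, hv, hℓ⟩ := (((tendsto_varFrom hAsv).eventually_lt_const hε).and
      (eventually_ge_atTop 1)).exists
    have hmem : {x' : SS Tr | Agree ℓ x x'} ∈ nhds x :=
      (isOpen_agree ℓ x).mem_nhds fun _ _ => rfl
    filter_upwards [mem_nhdsWithin_of_mem_nhds hmem, self_mem_nhdsWithin] with x' h hx'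
    have h1 := hdiff x hx x' hx' ℓ hℓ h
    have h2 := hdiff x' hx' x hx ℓ hℓ h.symm
    rw [Real.dist_eq, abs_lt]
    constructor <;> linarith
  · exact (ENNReal.tsum_le_tsum fun ℓ => hvar (1 + ℓ) (by omega)).trans_lt h

end CMS
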